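/- Let × be a cross product on a real inner product space V and let N ∈ V be a unit vector. Define J_N(X) := N × X and T(X,Y,Z) := −⟨N × (X × Y), Z⟩. Then for all X, Y, Z ∈ V orthogonal to N one has ⟨X × Y, Z⟩ + (1/2) T(X, J_N(Y), Z) + (1/2) T(X, Y, J_N(Z)) = 0. (Since ⟨(∇ᵍ_X J)Y, Z⟩ = ⟨X × Y, Z⟩ on the round sphere S⁶, this says that the metric connection with torsion T preserves the almost complex structure J_N, i.e. T is the characteristic torsion of the nearly Kähler S⁶.) -/

import Mathlib

open RealInnerProductSpace

section CrossProduct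

variable {V : Type*} [NormedAddCommGroup V] [InnerProductSpace ℝ V]
  {cross : V →ₗ[ℝ] V →ₗ[ℝ] V}

/-- A product satisfying the norm identity of a cross product is alternating. -/
theorem cross_self_eq_zero_of_norm_sq
    (h₃ : ∀ A B : V, ‖cross A B‖ ^ 2 = ‖A‖ ^ 2 * ‖B‖ ^ 2 - ⟪A, B⟫ ^ 2) (A : V) :
    cross A A = 0 := by
  have h := h₃ A A
  rw [real_inner_self_eq_norm_sq] at h
  have h' : ‖cross A A‖ ^ 2 = 0 := by rw [h]; ring
  simpa using h'

/-- Left multiplication by a vector is skew-adjoint. -/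
theorem inner_cross_left_eq_neg (h₂ : ∀ A B : V, ⟪cross A B, B⟫ = 0) (A B C : V) :
    ⟪cross A B, C⟫ = -⟪B, cross A C⟫ := by
  have h := h₂ A (B + C)
  simp only [map_add, inner_add_left, inner_add_right, h₂, zero_add, add_zero] at h
  rw [real_inner_comm (cross A C) B]
  linarith

theorem inner_cross_cross_left
    (h₃ : ∀ A B : V, ‖cross A B‖ ^ 2 = ‖A‖ ^ 2 * ‖B‖ ^ 2 - ⟪A, B⟫ ^ 2) (A B C : V) :
    ⟪cross A B, cross A C⟫ = ‖A‖ ^ 2 * ⟪B, C⟫ - ⟪A, B⟫ * ⟪A, C⟫ := by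
  have h := h₃ A (B + C)
  rw [map_add, norm_add_sq_real, norm_add_sq_real, inner_add_right, h₃ A B, h₃ A C] at h
  linarith

theorem cross_cross_left
    (h₂ : ∀ A B : V, ⟪cross A B, B⟫ = 0)
    (h₃ : ∀ A B : V, ‖cross A B‖ ^ 2 = ‖A‖ ^ 2 * ‖B‖ ^ 2 - ⟪A, B⟫ ^ 2) (A B : V) :
    cross A (cross A B) = ⟪A, B⟫ • A - ⟪A, A⟫ • B := by
  refine ext_inner_right ℝ fun C => ?_
  rw [inner_cross_left_eq_neg h₂, inner_cross_cross_left h₃, inner_sub_left,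
    real_inner_smul_left, real_inner_smul_left, real_inner_self_eq_norm_sq]
  ring

/-- Left multiplications by orthogonal vectors anticommute up to a term in their span. -/
theorem cross_cross_add_cross_cross
    (h₂ : ∀ A B : V, ⟪cross A B, B⟫ = 0)
    (h₃ : ∀ A B : V, ‖cross A B‖ ^ 2 = ‖A‖ ^ 2 * ‖B‖ ^ 2 - ⟪A, B⟫ ^ 2)
    {A B : V} (hAB : ⟪A, B⟫ = 0) (C : V) :
    cross A (cross B C) + cross B (cross A C) = ⟪A, C⟫ • B + ⟪B, C⟫ • A := by
  have h := cross_cross_left h₂ h₃ (A + B) C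
  have hBA : ⟪B, A⟫ = 0 := by rw [real_inner_comm, hAB]
  simp only [map_add, LinearMap.add_apply, inner_add_left, inner_add_right,
    cross_cross_left h₂ h₃, hAB, hBA, add_zero, zero_add, add_smul, smul_add] at h
  rw [← sub_eq_zero] at h ⊢
  rw [← h]
  abel

end CrossProduct

/-- For a cross product on a real inner product space and a unit
vector `N`, with `J_N(X) := N × X` and `T(X,Y,Z) := −⟪N × (X × Y), Z⟫`, every
triple `X, Y, Z` of vectors orthogonal to `N` satisfies
`⟪X × Y, Z⟫ + ½ T(X, J_N Y, Z) + ½ T(X, Y, J_N Z) = 0`. -/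
theorem cross_characteristic_torsion_preserves_J
    {V : Type*} [NormedAddCommGroup V] [InnerProductSpace ℝ V]
    (cross : V →ₗ[ℝ] V →ₗ[ℝ] V)
    (h₁ : ∀ A B : V, ⟪cross A B, A⟫ = 0)
    (h₂ : ∀ A B : V, ⟪cross A B, B⟫ = 0)
    (h₃ : ∀ A B : V, ‖cross A B‖ ^ 2 = ‖A‖ ^ 2 * ‖B‖ ^ 2 - ⟪A, B⟫ ^ 2)
    (N : V) (hN : ‖N‖ = 1)
    (J : V → V) (hJ : ∀ X : V, J X = cross N X)
    (T : V → V → V → ℝ)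
    (hT : ∀ X Y Z : V, T X Y Z = -⟪cross N (cross X Y), Z⟫) :
    ∀ X Y Z : V, ⟪X, N⟫ = 0 → ⟪Y, N⟫ = 0 → ⟪Z, N⟫ = 0 →
      ⟪cross X Y, Z⟫ + (1 / 2) * T X (J Y) Z + (1 / 2) * T X Y (J Z) = 0 := by
  intro X Y Z hX hY hZ
  have hNZ : ⟪N, Z⟫ = 0 := by rw [real_inner_comm, hZ]
  have hNN : ⟪N, N⟫ = 1 := by rw [real_inner_self_eq_norm_sq, hN, one_pow]
  have hNY : ⟪N, Y⟫ = 0 := by rw [real_inner_comm, hY]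
  have hJJ : ⟪cross N (cross N (cross X Y)), Z⟫ = -⟪cross X Y, Z⟫ := by
    rw [cross_cross_left h₂ h₃, inner_sub_left, real_inner_smul_left,
      real_inner_smul_left, hNZ, hNN]
    ring
  have hXJ : cross X (cross N Y) = ⟪X, Y⟫ • N - cross N (cross X Y) := by
    rw [eq_sub_iff_add_eq, cross_cross_add_cross_cross h₂ h₃ hX, hNY, zero_smul, add_zero]
  have hTY : T X (J Y) Z = -⟪cross X Y, Z⟫ := by
    rw [hT, hJ, hXJ, map_sub, map_smul, cross_self_eq_zero_of_norm_sq h₃, smul_zero,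
      zero_sub, inner_neg_left, hJJ, neg_neg]
  have hTZ : T X Y (J Z) = -⟪cross X Y, Z⟫ := by
    rw [hT, hJ, ← inner_cross_left_eq_neg h₂, hJJ]
  rw [hTY, hTZ]
  ring
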